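/- Let T be a complete first-order theory which is not strongly dependent, and let T₁ ⊇ T be a complete first-order theory with Skolem functions. Then there is a sequence φ̄ = ⟨φ_n(x, ȳ_n) : n < ω⟩ of first-order formulas in the vocabulary of T, with ȳ_n an initial segment of ȳ_{n+1}, such that for every structure J ∈ K^oi there exist a model M₁ of T₁ and tuples ⟨ā_t : t ∈ J⟩ satisfying: (a) M₁ is the Skolem hull of (the substructure generated by) ∪{Rang(ā_t) : t ∈ J}; (b) ā_t ∈ ^ω(M₁) for t ∈ Q^J, and ā_η = ⟨a_η⟩ is a single element of M₁ for η ∈ P^J; (c) for every η ∈ P^J, n < ω and t ∈ Q^J: M₁ ⊨ φ_n[a_η, ā_t ↾ lg(ȳ_n)] if and only if F^J_n(η) = t; (d) ⟨ā_t : t ∈ J⟩ is indiscernible in M₁ for the index model J. -/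

import Mathlib

open FirstOrder Cardinal

namespace EFGames

/-- The class `K^oi` (Definition 2b.1): structures `(|J|, P, Q, <, F_n)_{n<ω}` where `<` is a
linear order on `Q`, `P = |J| ∖ Q`, each `F_n` is the identity on `Q`, maps `P` into `Q` with
`F_n(a) < F_m(a)` for `n < m`, and distinct elements of `P` are separated by some `F_n`. -/
structure Koi : Type 1 where
  carrier : Type
  Q : Set carrier
  lt : carrier → carrier → Prop
  F : ℕ → carrier → carrier
  lt_mem : ∀ a b, lt a b → a ∈ Q ∧ b ∈ Q
  lt_irrefl : ∀ a, ¬ lt a a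
  lt_trans : ∀ a b c, lt a b → lt b c → lt a c
  lt_trichotomy : ∀ a ∈ Q, ∀ b ∈ Q, lt a b ∨ a = b ∨ lt b a
  F_mem : ∀ n a, F n a ∈ Q
  F_id : ∀ n, ∀ a ∈ Q, F n a = a
  F_lt : ∀ a ∉ Q, ∀ n m : ℕ, n < m → lt (F n a) (F m a)
  F_sep : ∀ a ∉ Q, ∀ b ∉ Q, a ≠ b → ∃ n, F n a ≠ F n b

/-- The closure of the generators under the (term) functions of a `K^oi`-structure:
`F_n` for `n < ω` together with the identity (`F_ω`). -/
def Koi.term (J : Koi) : Option ℕ → J.carrier → J.carrier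
  | none, a => a
  | some n, a => J.F n a

/-- Two systems of elements of `K^oi`-structures (indexed by the same index set) realize the
same quantifier-free type: the same atomic relations (`∈ Q`, equality and order of the
`F`-closures) hold. -/
def SameQfType (J J' : Koi) {ι : Type*} (s : ι → J.carrier) (t : ι → J'.carrier) : Prop :=
  (∀ i, s i ∈ J.Q ↔ t i ∈ J'.Q) ∧
  (∀ (g h : Option ℕ) (i j : ι),
    (J.term g (s i) = J.term h (s j) ↔ J'.term g (t i) = J'.term h (t j))) ∧
  (∀ (g h : Option ℕ) (i j : ι),
    (J.lt (J.term g (s i)) (J.term h (s j)) ↔ J'.lt (J'.term g (t i)) (J'.term h (t j))))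

/-- A complete first-order theory `T` is not strongly dependent (Definition 2b.2A): for some
sequence `⟨φ_n(x, ȳ_n) : n < ω⟩` of formulas and some infinite index set, the scheme `Γ_λ`
is consistent with `T`, i.e. is realized in some model of `T`. -/
def NotStronglyDependent {L : FirstOrder.Language.{0, 0}} (T : L.Theory) : Prop :=
  ∃ (ℓ : ℕ → ℕ) (φ : (n : ℕ) → L.Formula (Unit ⊕ Fin (ℓ n))) (X : Type) (_ : Infinite X)
    (M : Language.Theory.ModelType.{0, 0, 0} T) (b : (n : ℕ) → X → Fin (ℓ n) → M) (c : (ℕ → X) → M),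
    ∀ (η : ℕ → X) (n : ℕ) (α : X),
      ((φ n).Realize (Sum.elim (fun _ => c η) (b n α)) ↔ η n = α)

/-- The theory `T₁` has (definable) Skolem functions:  for every formula `φ(v̄, x)` there is a
term `t(v̄)` such that in every model of `T₁`, whenever `∃x φ(v̄, x)` holds, `φ(v̄, t(v̄))`
holds. -/
def HasSkolemFunctions {L' : FirstOrder.Language.{0, 0}} (T₁ : L'.Theory) : Prop :=
  ∀ (n : ℕ) (φ : L'.BoundedFormula (Fin n) 1),
    ∃ t : L'.Term (Fin n),
      ∀ (M : Language.Theory.ModelType.{0, 0, 0} T₁) (v : Fin n → M),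
        (∃ a : M, φ.Realize v (fun _ => a)) → φ.Realize v (fun _ => t.realize v)

section Helpers

open Filter

/-- Transfer: a model of the complete theory `T` maps `L`-elementarily into a model of `T₁`. -/
theorem exists_transfer {L L' : FirstOrder.Language.{0, 0}} (h : L →ᴸ L') (T : L.Theory)
    (T₁ : L'.Theory) (hT : T.IsComplete) (hT₁ : T₁.IsComplete) (hTT₁ : h.onTheory T ⊆ T₁)
    (M : Language.Theory.ModelType.{0, 0, 0} T) :
    ∃ (N : Language.Theory.ModelType.{0, 0, 0} T₁) (f : M → N),
      ∀ {α : Type} (ψ : L.Formula α) (v : α → M),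
        (h.onFormula ψ).Realize (fun i => f (v i)) ↔ ψ.Realize v := by
  classical
  obtain ⟨N⟩ := hT₁.1
  let _ : L.Structure N := h.reduct N
  have : N ⊨ T := (h.onTheory_model T).1 (N.is_model.mono hTT₁)
  have key : ∀ χ : L.Formula M, χ.Realize (fun m => m) → ∃ v : M → N, χ.Realize v := by
    intro χ hχ
    have h1 : M ⊨ χ.exClosure := by
      rw [Language.Formula.realize_exClosure]
      exact ⟨fun a => a, (Language.BoundedFormula.realize_restrictFreeVar (fun m => m)
        (fun _ => rfl)).2 hχ⟩
    have h2 : N ⊨ χ.exClosure :=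
      (hT.realize_sentence_iff _ N).2 ((hT.realize_sentence_iff _ M).1 h1)
    rw [Language.Formula.realize_exClosure] at h2
    obtain ⟨v, hv⟩ := h2
    let v' : M → N := fun a => if hmem : a ∈ χ.freeVarFinset
      then v ⟨a, hmem⟩ else Classical.choice inferInstance
    exact ⟨v', (Language.BoundedFormula.realize_restrictFreeVar v' (by grind)).1 hv⟩
  have key2 : ∀ Δ : Finset (L.Formula M), ∃ v : M → N,
      ∀ χ ∈ Δ, χ.Realize (fun m => m) → χ.Realize v := by
    intro Δ
    have : Finite {χ // χ ∈ Δ ∧ χ.Realize (fun m : M => m)} :=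
      Finite.of_injective (fun χ => (⟨χ.1, χ.2.1⟩ : Δ))
        (fun a b hab => Subtype.ext (congrArg (fun z : Δ => z.1) hab))
    obtain ⟨v, hv⟩ := key
      (Language.Formula.iInf (fun χ : {χ // χ ∈ Δ ∧ χ.Realize (fun m : M => m)} => χ.1))
      (by
        rw [Language.Formula.realize_iInf]
        exact fun b => b.2.2)
    rw [Language.Formula.realize_iInf] at hv
    exact ⟨v, fun χ h1 h2 => hv ⟨χ, h1, h2⟩⟩
  choose g hg using key2
  let V : Ultrafilter (Finset (L.Formula M)) := Ultrafilter.of atTop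
  let N' := (V : Filter (Finset (L.Formula M))).Product (fun _ => (N : Type))
  have : N' ⊨ T₁ := by
    rw [Language.Theory.model_iff]
    intro χ hχ
    rw [Language.Ultraproduct.sentence_realize]
    exact Eventually.of_forall fun _ => Language.Theory.realize_sentence_of_mem T₁ hχ
  let f : M → N' := fun m => ((fun Δ => g Δ m : Finset (L.Formula M) → N) : N')
  have hf : ∀ {α : Type} (ψ : L.Formula α) (v : α → M), ψ.Realize v →
        (h.onFormula ψ).Realize (fun i => f (v i)) := by
    intro α ψ v hψ
    refine (Language.Ultraproduct.realize_formula_cast (h.onFormula ψ)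
      (fun i Δ => g Δ (v i))).2 ?_
    have : ∀ᶠ Δ in (V : Filter (Finset (L.Formula M))), ψ.relabel v ∈ Δ := by
      apply Ultrafilter.of_le (atTop : Filter (Finset (L.Formula M)))
      filter_upwards [eventually_ge_atTop {ψ.relabel v}] with Δ hΔ
      exact hΔ (Finset.mem_singleton_self _)
    filter_upwards [this] with Δ hΔ
    rw [Language.LHom.realize_onFormula]
    have := hg Δ _ hΔ (by rw [Language.Formula.realize_relabel]; exact hψ)
    rw [Language.Formula.realize_relabel] at this
    exact this
  refine ⟨Language.Theory.ModelType.of T₁ N', f, ?_⟩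
  intro α ψ v
  refine ⟨fun h1 => ?_, hf ψ v⟩
  by_contra h2
  exact hf ψ.not v h2 h1

/-- Skolem hulls. -/
theorem exists_hull {L' : FirstOrder.Language.{0, 0}} (T₁ : L'.Theory)
    (hSk : HasSkolemFunctions T₁) (N : Language.Theory.ModelType.{0, 0, 0} T₁) (A : Set N) :
    ∃ (M₁ : Language.Theory.ModelType.{0, 0, 0} T₁) (e : M₁ ↪ₑ[L'] N),
      Language.Substructure.closure L' (e ⁻¹' A) = ⊤ ∧ A ⊆ Set.range e := by
  let S := Language.Substructure.closure L' A
  have hS : S.IsElementary := by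
    apply S.isElementary_of_exists
    intro n φ x a ha
    let gg : Empty ⊕ Fin (n + 1) → Fin n ⊕ Fin 1 :=
      Sum.elim Empty.elim (fun i => Fin.lastCases (Sum.inr 0) (fun i => Sum.inl i) i)
    let χ : L'.BoundedFormula (Fin n) 1 :=
      Language.BoundedFormula.relabel (n := 1) (k := 0) gg φ.toFormula
    obtain ⟨t, ht⟩ := hSk n χ
    have hr : ∀ a : N, χ.Realize (fun i => (x i : N)) (fun _ => a) ↔
        φ.Realize default (Fin.snoc ((↑) ∘ x) a : _ → N) := by
      intro a
      have h1 := Language.BoundedFormula.realize_relabel (φ := φ.toFormula) (g := gg)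
        (v := fun i => (x i : N)) (xs := fun _ => a)
      refine h1.trans ?_
      have h2 := Language.BoundedFormula.realize_toFormula φ
        (Sum.elim (default : Empty → N) (Fin.snoc ((↑) ∘ x) a : Fin (n + 1) → N))
      rw [Sum.elim_comp_inl, Sum.elim_comp_inr] at h2
      refine Iff.trans ?_ h2
      rw [Language.Formula.Realize]
      have h3 : (Sum.elim (fun i => (x i : N)) ((fun _ => a) ∘ Fin.castAdd 0) ∘ gg) =
          Sum.elim (default : Empty → N) (Fin.snoc ((↑) ∘ x) a : Fin (n + 1) → N) := by
        ext i
        rcases i with i | i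
        · exact i.elim
        · cases i using Fin.lastCases <;> simp [gg]
      rw [h3, Subsingleton.elim ((fun _ => a) ∘ Fin.natAdd 1 : Fin 0 → N) default]
    refine ⟨⟨t.realize (fun i => (x i : N)), ?_⟩, ?_⟩
    · exact Language.Term.realize_mem t _ (fun i => (x i).2)
    · exact (hr _).1 (ht N _ ⟨a, (hr a).2 ha⟩)
  let E : L'.ElementarySubstructure N := ⟨S, hS⟩
  obtain ⟨t, ht⟩ := hSk 0 ⊤
  have : Nonempty E := ⟨⟨t.realize Fin.elim0, Language.Term.realize_mem t _ (fun i => i.elim0)⟩⟩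
  refine ⟨Language.Theory.ModelType.of T₁ E, E.subtype, ?_, ?_⟩
  · rw [eq_top_iff]
    rintro x -
    have hx : E.subtype x ∈ Language.Substructure.closure L' A := x.2
    have hA : A = E.subtype.toHom '' (E.subtype ⁻¹' A) := by
      ext a
      constructor
      · intro ha
        exact ⟨⟨a, Language.Substructure.subset_closure ha⟩, ha, rfl⟩
      · rintro ⟨y, hy, rfl⟩
        exact hy
    rw [hA, ← Language.Substructure.map_closure] at hx
    obtain ⟨y, hy, hyx⟩ := hx
    have : y = x := Subtype.ext hyx
    exact this ▸ hy
  · intro a ha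
    exact ⟨⟨a, Language.Substructure.subset_closure ha⟩, rfl⟩

end Helpers

section Helpers2

open Filter Classical

/-- The iterated ultrafilter along a list of coordinates. -/
noncomputable def iterU {I X : Type} (U : Ultrafilter X) : List I → (I → X) → Ultrafilter (I → X)
  | [], x => pure x
  | t :: l, x => Ultrafilter.bind U (fun v => iterU U l (Function.update x t v))

theorem iterU_nil {I X : Type} (U : Ultrafilter X) (x : I → X) (p : (I → X) → Prop) :
    (∀ᶠ y in (iterU U [] x : Filter (I → X)), p y) ↔ p x := Iff.rfl

theorem iterU_cons {I X : Type} (U : Ultrafilter X) (t : I) (l : List I) (x : I → X)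
    (p : (I → X) → Prop) :
    (∀ᶠ y in (iterU U (t :: l) x : Filter (I → X)), p y) ↔
      ∀ᶠ v in (U : Filter X), ∀ᶠ y in (iterU U l (Function.update x t v) : Filter (I → X)), p y :=
  Iff.rfl

theorem iterU_filter {I X : Type} (U : Ultrafilter X) (S : Set I) (p : (I → X) → Prop)
    (hp : ∀ y y' : I → X, (∀ s ∈ S, y s = y' s) → (p y ↔ p y')) (l : List I) :
    ∀ x x' : I → X, (∀ s ∈ S, x s = x' s) →
      ((∀ᶠ y in (iterU U l x : Filter (I → X)), p y) ↔
        ∀ᶠ y in (iterU U (l.filter (fun i => decide (i ∈ S))) x' : Filter (I → X)), p y) := by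
  induction l with
  | nil => intro x x' h; exact hp x x' h
  | cons t l ih =>
    intro x x' h
    by_cases ht : t ∈ S
    · rw [List.filter_cons_of_pos (by simpa using ht), iterU_cons, iterU_cons]
      refine eventually_congr (Eventually.of_forall fun v => ih _ _ fun s hs => ?_)
      by_cases hst : s = t
      · subst hst; simp
      · simp [hst, h s hs]
    · rw [List.filter_cons_of_neg (by simpa using ht), iterU_cons]
      rw [← eventually_const (f := (U : Filter X))
        (p := ∀ᶠ y in (iterU U (l.filter (fun i => decide (i ∈ S))) x' : Filter (I → X)), p y)]
      refine eventually_congr (Eventually.of_forall fun v => ih _ _ fun s hs => ?_)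
      have hst : s ≠ t := fun e => ht (e ▸ hs)
      simp [hst, h s hs]

theorem iterU_map {I X : Type} (U : Ultrafilter X) (S : Set I) (e : I → I) (he : Set.InjOn e S)
    (p p' : (I → X) → Prop)
    (hp : ∀ y y' : I → X, (∀ s ∈ S, y s = y' (e s)) → (p y ↔ p' y')) (l : List I) :
    (∀ a ∈ l, a ∈ S) → ∀ x x' : I → X, (∀ s ∈ S, x s = x' (e s)) →
      ((∀ᶠ y in (iterU U l x : Filter (I → X)), p y) ↔
        ∀ᶠ y in (iterU U (l.map e) x' : Filter (I → X)), p' y) := by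
  induction l with
  | nil => intro _ x x' h; exact hp x x' h
  | cons t l ih =>
    intro hl x x' h
    rw [List.map_cons, iterU_cons, iterU_cons]
    refine eventually_congr (Eventually.of_forall fun v =>
      ih (fun a ha => hl a (List.mem_cons_of_mem _ ha)) _ _ fun s hs => ?_)
    by_cases hst : s = t
    · subst hst; simp
    · have : e s ≠ e t := fun h' => hst (he hs (hl t List.mem_cons_self) h')
      simp [hst, this, h s hs]

theorem iterU_notMem {I X : Type} (U : Ultrafilter X) (j : I) (l : List I) (hj : j ∉ l) :
    ∀ x : I → X, ∀ᶠ y in (iterU U l x : Filter (I → X)), y j = x j := by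
  induction l with
  | nil => intro x; exact (iterU_nil U x _).2 rfl
  | cons t l ih =>
    intro x
    rw [List.mem_cons, not_or] at hj
    rw [iterU_cons]
    refine Eventually.of_forall fun v => ?_
    have := ih hj.2 (Function.update x t v)
    rwa [Function.update_of_ne hj.1] at this

theorem iterU_ne_const {I X : Type} (U : Ultrafilter X) (hU : (U : Filter X) ≤ cofinite)
    (j : I) (w : X) (l : List I) (hj : j ∈ l) :
    ∀ x : I → X, ∀ᶠ y in (iterU U l x : Filter (I → X)), y j ≠ w := by
  induction l with
  | nil => simp at hj
  | cons t l ih =>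
    intro x
    rw [iterU_cons]
    by_cases hjl : j ∈ l
    · exact Eventually.of_forall fun v => ih hjl _
    · have hjt : j = t := by simpa [hjl] using hj
      subst hjt
      have : ∀ᶠ v in (U : Filter X), v ≠ w := hU (Set.finite_singleton w).compl_mem_cofinite
      filter_upwards [this] with v hv
      filter_upwards [iterU_notMem U j l hjl (Function.update x j v)] with y hy
      rw [hy]; simpa using hv

theorem iterU_ne {I X : Type} (U : Ultrafilter X) (hU : (U : Filter X) ≤ cofinite)
    (i j : I) (hij : i ≠ j) (l : List I) (hi : i ∈ l) (hj : j ∈ l) :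
    ∀ x : I → X, ∀ᶠ y in (iterU U l x : Filter (I → X)), y i ≠ y j := by
  induction l with
  | nil => simp at hj
  | cons t l ih =>
    intro x
    rw [iterU_cons]
    refine Eventually.of_forall fun v => ?_
    by_cases hil : i ∈ l
    · by_cases hjl : j ∈ l
      · exact ih hil hjl _
      · filter_upwards [iterU_notMem U j l hjl (Function.update x t v),
          iterU_ne_const U hU i (Function.update x t v j) l hil (Function.update x t v)]
          with y h1 h2
        rwa [h1]
    · have hit : i = t := by simpa [hil] using hi
      have hjl : j ∈ l := by
        rcases List.mem_cons.1 hj with h | h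
        · exact absurd (hit.trans h.symm) hij
        · exact h
      filter_upwards [iterU_notMem U i l hil (Function.update x t v),
          iterU_ne_const U hU j (Function.update x t v i) l hjl (Function.update x t v)]
          with y h1 h2
      rw [h1]; exact h2.symm

theorem Koi.exists_sorted (J : Koi) (A : Finset J.carrier) :
    ∃ l : List J.carrier, l.Pairwise J.lt ∧ ∀ a, a ∈ l ↔ a ∈ A ∧ a ∈ J.Q := by
  have : IsStrictTotalOrder J.Q (fun a b => J.lt a b) :=
    { trichotomous := by
        intro a b h1 h2
        rcases J.lt_trichotomy a a.2 b b.2 with h | h | h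
        · exact absurd h h1
        · exact Subtype.ext h
        · exact absurd h h2
      irrefl := fun a => J.lt_irrefl a
      trans := fun a b c => J.lt_trans a b c }
  let _ : LinearOrder J.Q := linearOrderOfSTO (fun a b => J.lt a b)
  refine ⟨((A.subtype (· ∈ J.Q)).sort).map Subtype.val, ?_, ?_⟩
  · rw [List.pairwise_map]
    exact (Finset.sortedLT_sort (A.subtype (· ∈ J.Q))).pairwise
  · intro a
    simp [and_comm]

theorem Koi.pairwise_unique (J : Koi) (l l' : List J.carrier) (h : l.Pairwise J.lt)
    (h' : l'.Pairwise J.lt) (hm : ∀ a, a ∈ l ↔ a ∈ l') : l = l' := by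
  have : Std.Irrefl J.lt := ⟨J.lt_irrefl⟩
  have : Std.Antisymm J.lt := ⟨fun a b h1 h2 => absurd (J.lt_trans _ _ _ h1 h2) (J.lt_irrefl a)⟩
  exact List.Pairwise.eq_of_mem_iff h h' hm

/-- Invariance of the iterated ultrafilter limit under order isomorphisms of finite supports. -/
theorem Koi.invariance (J : Koi) {X : Type} (U : Ultrafilter X) {κ : Type} (f f' : κ → J.carrier)
    (heq : ∀ a b, f a = f b ↔ f' a = f' b) (hlt : ∀ a b, J.lt (f a) (f b) ↔ J.lt (f' a) (f' b))
    (p p' : (J.carrier → X) → Prop)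
    (hpp : ∀ y y' : J.carrier → X, (∀ a, y (f a) = y' (f' a)) → (p y ↔ p' y'))
    (l : List J.carrier) (hl : l.Pairwise J.lt) (hf : ∀ a, f a ∈ l) (hf' : ∀ a, f' a ∈ l)
    (x₀ : X) :
    (∀ᶠ y in (iterU U l (fun _ => x₀) : Filter (J.carrier → X)), p y) ↔
      ∀ᶠ y in (iterU U l (fun _ => x₀) : Filter (J.carrier → X)), p' y := by
  let e : J.carrier → J.carrier := Function.extend f f' id
  have he : ∀ a, e (f a) = f' a :=
    Function.FactorsThrough.extend_apply (fun a b h => (heq a b).1 h) id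
  have hinj : Set.InjOn e (Set.range f) := by
    rintro _ ⟨a, rfl⟩ _ ⟨b, rfl⟩ h
    rw [he, he] at h
    exact (heq a b).2 h
  have hp1 : ∀ y y' : J.carrier → X, (∀ s ∈ Set.range f, y s = y' s) → (p y ↔ p y') := by
    intro y y' h
    let z : J.carrier → X := Function.extend f' (fun a => y (f a)) y
    have hz : ∀ a, z (f' a) = y (f a) :=
      Function.FactorsThrough.extend_apply
        (fun a b h => congrArg y ((heq a b).2 h)) y
    exact (hpp y z (fun a => (hz a).symm)).trans
      (hpp y' z (fun a => by rw [hz, h _ ⟨a, rfl⟩])).symm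
  have hp2 : ∀ y y' : J.carrier → X, (∀ s ∈ Set.range f', y s = y' s) → (p' y ↔ p' y') := by
    intro y y' h
    let z : J.carrier → X := Function.extend f (fun a => y (f' a)) y
    have hz : ∀ a, z (f a) = y (f' a) :=
      Function.FactorsThrough.extend_apply
        (fun a b h => congrArg y ((heq a b).1 h)) y
    exact (hpp z y (fun a => hz a)).symm.trans
      (hpp z y' (fun a => by rw [hz, h _ ⟨a, rfl⟩]))
  rw [iterU_filter U (Set.range f) p hp1 l _ (fun _ => x₀) (fun _ _ => rfl),
    iterU_filter U (Set.range f') p' hp2 l _ (fun _ => x₀) (fun _ _ => rfl)]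
  have hl' : l.filter (fun i => decide (i ∈ Set.range f')) =
      (l.filter (fun i => decide (i ∈ Set.range f))).map e := by
    apply J.pairwise_unique
    · exact hl.filter _
    · rw [List.pairwise_map]
      refine List.Pairwise.imp_of_mem ?_ (hl.filter _)
      intro a b ha hb hab
      rw [List.mem_filter] at ha hb
      obtain ⟨a, rfl⟩ := of_decide_eq_true ha.2
      obtain ⟨b, rfl⟩ := of_decide_eq_true hb.2
      rw [he, he]
      exact (hlt a b).1 hab
    · intro a
      simp only [List.mem_filter, List.mem_map, decide_eq_true_eq]
      constructor
      · rintro ⟨-, b, rfl⟩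
        exact ⟨f b, ⟨hf b, b, rfl⟩, he b⟩
      · rintro ⟨_, ⟨-, b, rfl⟩, rfl⟩
        rw [he]
        exact ⟨hf' b, b, rfl⟩
  rw [hl']
  refine iterU_map U (Set.range f) e hinj p p' ?_ _ ?_ _ _ (fun _ _ => rfl)
  · intro y y' h
    exact hpp y y' (fun a => by rw [h _ ⟨a, rfl⟩, he])
  · intro a ha
    exact of_decide_eq_true (List.mem_filter.1 ha).2

end Helpers2

/-- Claim 2b.3.  If `T ⊆ T₁` are complete first-order theories, `T₁` with
Skolem functions, and `T` is not strongly dependent, then there is a sequence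
`φ̄ = ⟨φ_n(x, ȳ_n) : n < ω⟩` of formulas of `τ(T)` (with `ȳ_n ⊴ ȳ_{n+1}`, i.e. lengths
nondecreasing) such that for every `J ∈ K^oi` there are a model `M₁ ⊨ T₁` and tuples
`⟨ā_t : t ∈ J⟩` (of length `ω` for `t ∈ Q^J`, constant — i.e. of length `1` — for
`η ∈ P^J`) such that: (a) `M₁` is the Skolem hull of the union of the tuples; (b) as above;
(c) `M₁ ⊨ φ_n[a_η, ā_t ↾ lg(ȳ_n)]` iff `F^J_n(η) = t`; (d) `⟨ā_t : t ∈ J⟩` is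
indiscernible in `M₁` for the index model `J`. -/
theorem exists_indiscernibles_of_notStronglyDependent
    {L L' : FirstOrder.Language.{0, 0}} (h : L →ᴸ L') (T : L.Theory) (T₁ : L'.Theory)
    (hT : T.IsComplete) (hT₁ : T₁.IsComplete) (hTT₁ : h.onTheory T ⊆ T₁)
    (hSk : HasSkolemFunctions T₁) (hnsd : NotStronglyDependent T) :
    ∃ (ℓ : ℕ → ℕ) (φ : (n : ℕ) → L.Formula (Unit ⊕ Fin (ℓ n))),
      (∀ n, ℓ n ≤ ℓ (n + 1)) ∧
      ∀ J : Koi, ∃ (M₁ : Language.Theory.ModelType.{0, 0, 0} T₁) (b : J.carrier → ℕ → M₁),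
        -- (a) `M₁` is the Skolem hull of `{ā_t : t ∈ J}`
        Language.Substructure.closure L' (⋃ t, Set.range (b t)) = ⊤ ∧
        -- (b) for `η ∈ P^J` the tuple `ā_η` is a single element `a_η`
        (∀ η, η ∉ J.Q → ∀ k, b η k = b η 0) ∧
        -- (c)
        (∀ η, η ∉ J.Q → ∀ (n : ℕ), ∀ t ∈ J.Q,
          (((h.onFormula (φ n)).Realize
            (Sum.elim (fun _ => b η 0) (fun i : Fin (ℓ n) => b t i)) : Prop) ↔ J.F n η = t)) ∧
        -- (d) indiscernibility for the index model `J`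
        (∀ (n : ℕ) (s t : Fin n → J.carrier), SameQfType J J s t →
          ∀ ψ : L'.Formula (Fin n × ℕ),
            (ψ.Realize (fun q => b (s q.1) q.2) ↔ ψ.Realize (fun q => b (t q.1) q.2))) := by
  classical
  obtain ⟨ℓ, φ, X, hX, M, b, c, hbc⟩ := hnsd
  obtain ⟨N, f, hf⟩ := exists_transfer h T T₁ hT hT₁ hTT₁ M
  let ℓ' : ℕ → ℕ := fun n => ∑ m ∈ Finset.range (n + 1), Nat.pair m (ℓ m)
  have hℓ' : ∀ n (i : Fin (ℓ n)), Nat.pair n i < ℓ' n := fun n i =>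
    lt_of_lt_of_le (Nat.pair_lt_pair_right n i.2)
      (Finset.single_le_sum (f := fun m => Nat.pair m (ℓ m)) (fun _ _ => Nat.zero_le _)
        (Finset.mem_range.2 (Nat.lt_succ_self n)))
  let φ' : (n : ℕ) → L.Formula (Unit ⊕ Fin (ℓ' n)) := fun n =>
    (φ n).relabel (Sum.map id (fun i : Fin (ℓ n) => ⟨Nat.pair n i, hℓ' n i⟩))
  obtain ⟨x₀⟩ : Nonempty X := inferInstance
  let B : X → ℕ → M := fun α k =>
    if hk : (Nat.unpair k).2 < ℓ (Nat.unpair k).1 then b (Nat.unpair k).1 α ⟨_, hk⟩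
    else c (fun _ => x₀)
  have hB : ∀ n α (i : Fin (ℓ n)), B α (Nat.pair n i) = b n α i := by
    intro n α i
    have : ∀ (q : ℕ × ℕ) (_ : q = (n, (i : ℕ))),
        (if hk : q.2 < ℓ q.1 then b q.1 α ⟨_, hk⟩ else c (fun _ => x₀)) = b n α i := by
      rintro _ rfl
      simp
    exact this _ (Nat.unpair_pair n i)
  have hφ' : ∀ (η : ℕ → X) (n : ℕ) (α : X),
      (h.onFormula (φ' n)).Realize (Sum.elim (fun _ => f (c η))
        (fun i : Fin (ℓ' n) => f (B α i))) ↔ η n = α := by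
    intro η n α
    have h1 := hf (φ' n) (Sum.elim (fun _ => c η) (fun i : Fin (ℓ' n) => B α i))
    have h2 : (fun i => f (Sum.elim (fun _ : Unit => c η) (fun i : Fin (ℓ' n) => B α i) i)) =
        Sum.elim (fun _ => f (c η)) (fun i : Fin (ℓ' n) => f (B α i)) := by
      ext i; rcases i with i | i <;> rfl
    rw [h2] at h1
    rw [h1, ← hbc η n α, Language.Formula.realize_relabel]
    have h3 : (Sum.elim (fun _ : Unit => c η) (fun i : Fin (ℓ' n) => B α i) ∘
        Sum.map id (fun i : Fin (ℓ n) => ⟨Nat.pair n i, hℓ' n i⟩)) = Sum.elim (fun _ => c η) (b n α) := by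
      ext i
      rcases i with i | i
      · rfl
      · exact hB n α i
    rw [h3]
  refine ⟨ℓ', φ', ?_, ?_⟩
  · intro n
    simp only [ℓ']
    rw [Finset.sum_range_succ _ (n + 1)]
    exact Nat.le_add_right _ _
  intro J
  choose srt hsrt hmem using J.exists_sorted
  let U : Ultrafilter X := Filter.hyperfilter X
  have hU : (U : Filter X) ≤ Filter.cofinite := Filter.hyperfilter_le_cofinite
  let V : Ultrafilter (Finset J.carrier) := Ultrafilter.of Filter.atTop
  have hV : (V : Filter (Finset J.carrier)) ≤ Filter.atTop := Ultrafilter.of_le _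
  let W : Ultrafilter (ℕ × (J.carrier → X)) :=
    Ultrafilter.bind (Filter.hyperfilter ℕ) (fun m => Ultrafilter.bind V (fun A =>
      Ultrafilter.map (fun x => (m, x)) (iterU U (srt A) (fun _ => x₀))))
  have hW : ∀ p : ℕ × (J.carrier → X) → Prop,
      (∀ᶠ z in (W : Filter (ℕ × (J.carrier → X))), p z) ↔
      ∀ᶠ m in (Filter.hyperfilter ℕ : Filter ℕ), ∀ᶠ A in (V : Filter (Finset J.carrier)),
        ∀ᶠ x in (iterU U (srt A) (fun _ => x₀) : Filter (J.carrier → X)), p (m, x) :=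
    fun p => Iff.rfl
  let P := (W : Filter (ℕ × (J.carrier → X))).Product (fun _ => (N : Type))
  have hP : P ⊨ T₁ := by
    rw [Language.Theory.model_iff]
    intro χ hχ
    rw [Language.Ultraproduct.sentence_realize]
    exact Filter.Eventually.of_forall fun _ => Language.Theory.realize_sentence_of_mem T₁ hχ
  let G : ℕ × (J.carrier → X) → J.carrier → ℕ → N := fun z t k =>
    if t ∈ J.Q then f (B (z.2 t) k)
    else f (c (fun n => if n < z.1 then z.2 (J.F n t) else x₀))
  let b₀ : J.carrier → ℕ → P := fun t k =>
    ((fun z => G z t k : ℕ × (J.carrier → X) → N) : P)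
  have hLos : ∀ {α : Type} (ψ : L'.Formula α) (g : α → J.carrier × ℕ),
      ψ.Realize (fun i => b₀ (g i).1 (g i).2) ↔
        ∀ᶠ z in (W : Filter (ℕ × (J.carrier → X))), ψ.Realize (fun i => G z (g i).1 (g i).2) :=
    fun ψ g => Language.Ultraproduct.realize_formula_cast ψ (fun i z => G z (g i).1 (g i).2)
  obtain ⟨M₁, e, hcl, hrange⟩ := exists_hull T₁ hSk (Language.Theory.ModelType.of T₁ P)
    (⋃ t, Set.range (b₀ t))
  have hex : ∀ t k, ∃ a : M₁, e a = b₀ t k := fun t k =>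
    hrange (Set.mem_iUnion.2 ⟨t, k, rfl⟩)
  choose b₁ hb₁ using hex
  have hreal : ∀ {α : Type} (ψ : L'.Formula α) (g : α → J.carrier × ℕ),
      ψ.Realize (fun i => b₁ (g i).1 (g i).2) ↔
        ∀ᶠ z in (W : Filter (ℕ × (J.carrier → X))), ψ.Realize (fun i => G z (g i).1 (g i).2) := by
    intro α ψ g
    rw [← hLos, ← e.map_formula]
    have : (e ∘ fun i => b₁ (g i).1 (g i).2) = fun i => b₀ (g i).1 (g i).2 :=
      funext fun i => hb₁ _ _
    rw [this]
    rfl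
  have hmemV : ∀ t ∈ J.Q, ∀ᶠ A in (V : Filter (Finset J.carrier)), t ∈ srt A := by
    intro t ht
    apply hV
    filter_upwards [Filter.eventually_ge_atTop {t}] with A hA
    exact (hmem A t).2 ⟨hA (Finset.mem_singleton_self t), ht⟩
  refine ⟨M₁, b₁, ?_, ?_, ?_, ?_⟩
  · rw [← hcl]
    congr 1
    ext a
    simp only [Set.mem_iUnion, Set.mem_range, Set.mem_preimage]
    constructor
    · rintro ⟨t, k, rfl⟩
      exact ⟨t, k, (hb₁ t k).symm⟩
    · rintro ⟨t, k, hk⟩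
      exact ⟨t, k, e.injective (by rw [hb₁, hk])⟩
  · intro η hη k
    apply e.injective
    rw [hb₁, hb₁]
    simp only [b₀, G, if_neg hη]
    rfl
  · intro η hη n t ht
    have h1 := hreal (h.onFormula (φ' n)) (Sum.elim (fun _ => (η, 0)) (fun i => (t, (i : ℕ))))
    have h2 : (fun i => b₁ ((Sum.elim (fun _ => (η, 0)) (fun i => (t, (i : ℕ))) :
        Unit ⊕ Fin (ℓ' n) → J.carrier × ℕ) i).1 ((Sum.elim (fun _ => (η, 0))
          (fun i => (t, (i : ℕ))) : Unit ⊕ Fin (ℓ' n) → J.carrier × ℕ) i).2) =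
        Sum.elim (fun _ => b₁ η 0) (fun i : Fin (ℓ' n) => b₁ t i) := by
      ext i; rcases i with i | i <;> rfl
    rw [h2] at h1
    rw [h1]
    have h3 : ∀ z : ℕ × (J.carrier → X), (h.onFormula (φ' n)).Realize
        (fun i => G z ((Sum.elim (fun _ => (η, 0)) (fun i => (t, (i : ℕ))) :
        Unit ⊕ Fin (ℓ' n) → J.carrier × ℕ) i).1 ((Sum.elim (fun _ => (η, 0))
          (fun i => (t, (i : ℕ))) : Unit ⊕ Fin (ℓ' n) → J.carrier × ℕ) i).2) ↔
        (if n < z.1 then z.2 (J.F n η) else x₀) = z.2 t := by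
      intro z
      rw [← hφ' (fun n => if n < z.1 then z.2 (J.F n η) else x₀) n (z.2 t)]
      have : (fun i => G z ((Sum.elim (fun _ => (η, 0)) (fun i => (t, (i : ℕ))) :
        Unit ⊕ Fin (ℓ' n) → J.carrier × ℕ) i).1 ((Sum.elim (fun _ => (η, 0))
          (fun i => (t, (i : ℕ))) : Unit ⊕ Fin (ℓ' n) → J.carrier × ℕ) i).2) =
          Sum.elim (fun _ => f (c (fun n => if n < z.1 then z.2 (J.F n η) else x₀)))
            (fun i : Fin (ℓ' n) => f (B (z.2 t) i)) := by
        ext i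
        rcases i with i | i
        · simp [G, hη]
        · simp [G, ht]
      rw [this]
    simp only [h3]
    have hgt : ∀ᶠ m in (Filter.hyperfilter ℕ : Filter ℕ), n < m :=
      Nat.hyperfilter_le_atTop (Filter.eventually_gt_atTop n)
    constructor
    · intro hev
      by_contra hne
      have hev' : ∀ᶠ z in (W : Filter (ℕ × (J.carrier → X))),
          ¬ ((if n < z.1 then z.2 (J.F n η) else x₀) = z.2 t) := by
        rw [hW]
        filter_upwards [hgt] with m hm
        filter_upwards [hmemV _ (J.F_mem n η), hmemV t ht] with A h4 h5
        filter_upwards [iterU_ne U hU _ _ hne _ h4 h5 (fun _ => x₀)] with y hy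
        rwa [if_pos hm]
      obtain ⟨z, hz1, hz2⟩ := (hev.and hev').exists
      exact hz2 hz1
    · intro heq
      rw [hW]
      filter_upwards [hgt] with m hm
      refine Filter.Eventually.of_forall fun A => Filter.Eventually.of_forall fun x => ?_
      rw [if_pos hm, heq]
  · intro n s t hst ψ
    rw [hreal ψ (fun q => (s q.1, q.2)), hreal ψ (fun q => (t q.1, q.2)), hW, hW]
    refine Filter.eventually_congr (Filter.Eventually.of_forall fun m => ?_)
    have hall : ∀ r : Fin n → J.carrier, ∀ᶠ A in (V : Filter (Finset J.carrier)),
        ∀ a : Fin n × Fin (m + 1), J.F a.2 (r a.1) ∈ srt A := fun r =>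
      Filter.eventually_all.2 fun a => hmemV _ (J.F_mem _ _)
    refine Filter.eventually_congr ?_
    filter_upwards [hall s, hall t] with A hs ht
    refine J.invariance U (κ := Fin n × Fin (m + 1)) (fun a => J.F a.2 (s a.1))
      (fun a => J.F a.2 (t a.1)) ?_ ?_ _ _ ?_ (srt A) (hsrt A) hs ht x₀
    · intro a a'
      exact hst.2.1 (some a.2) (some a'.2) a.1 a'.1
    · intro a a'
      exact hst.2.2 (some a.2) (some a'.2) a.1 a'.1
    · intro y y' hyy
      have : (fun q : Fin n × ℕ => G (m, y) (s q.1) q.2) =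
          fun q : Fin n × ℕ => G (m, y') (t q.1) q.2 := by
        ext q
        by_cases hq : s q.1 ∈ J.Q
        · have hq' := (hst.1 q.1).1 hq
          have h0 := hyy (q.1, 0)
          simp only [J.F_id _ _ hq, J.F_id _ _ hq'] at h0
          simp only [G, if_pos hq, if_pos hq', h0]
        · have hq' : t q.1 ∉ J.Q := fun h' => hq ((hst.1 q.1).2 h')
          simp only [G, if_neg hq, if_neg hq']
          congr 2
          ext k
          by_cases hk : k < m
          · rw [if_pos hk, if_pos hk]
            exact hyy (q.1, ⟨k, Nat.lt_succ_of_lt hk⟩)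
          · rw [if_neg hk, if_neg hk]
      simp only [this]

end EFGames
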